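/- arXiv:1902.07962 — 3 statements merged into one kernel-verified Lean document; each statement's English description precedes it below -/
import Mathlib

section
/- The class 𝒢 is closed under arbitrary coproducts: if (G_j)_{j∈J} is a family of groups each belonging to 𝒢, then the free product (coproduct) ⋆_{j∈J} G_j is in 𝒢. -/
universe u

/-- A (multiplicative) group is a direct sum of cyclic groups if it is isomorphic to
`Multiplicative` of a direct sum `⨁ i, ZMod (n i)` (recall `ZMod 0 = ℤ`). -/
def IsDirectSumOfCyclic (A : Type u) [Group A] : Prop :=
  ∃ (ι : Type u) (n : ι → ℕ),
    Nonempty (A ≃* Multiplicative (DirectSum ι fun i => ZMod (n i)))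

/-- The class `𝒢` of groups: every torsion subgroup is finite and every abelian subgroup is
a direct sum of cyclic groups. -/
def InClassG (G : Type u) [Group G] : Prop :=
  (∀ T : Subgroup G, (∀ x ∈ T, IsOfFinOrder x) → (T : Set G).Finite) ∧
  (∀ A : Subgroup G, (∀ x ∈ A, ∀ y ∈ A, x * y = y * x) → IsDirectSumOfCyclic A)

namespace Monoid.CoprodI

section NeWord

variable {ι : Type*} {G : ι → Type*} [∀ i, Group (G i)]

theorem NeWord.toWord_inj_of_prod_eq {i j k l : ι} {w : NeWord G i j} {v : NeWord G k l}
    (h : w.prod = v.prod) : w.toWord = v.toWord := by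
  classical
  exact Word.equiv.symm.injective h

theorem NeWord.fst_eq_of_prod_eq {i j k l : ι} {w : NeWord G i j} {v : NeWord G k l}
    (h : w.prod = v.prod) : i = k := by
  have hl : w.toList = v.toList := congrArg Word.toList (toWord_inj_of_prod_eq h)
  have := congrArg List.head? hl
  rw [toList_head?, toList_head?] at this
  exact congrArg Sigma.fst (Option.some.inj this)

theorem NeWord.snd_eq_of_prod_eq {i j k l : ι} {w : NeWord G i j} {v : NeWord G k l}
    (h : w.prod = v.prod) : j = l := by
  have hl : w.toList = v.toList := congrArg Word.toList (toWord_inj_of_prod_eq h)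
  have := congrArg List.getLast? hl
  rw [toList_getLast?, toList_getLast?] at this
  exact congrArg Sigma.fst (Option.some.inj this)

theorem NeWord.prod_ne_one {i j : ι} (w : NeWord G i j) : w.prod ≠ 1 := by
  classical
  intro h
  have h' : w.toWord = Word.empty := Word.equiv.symm.injective h
  exact w.toList_ne_nil (congrArg Word.toList h')

theorem exists_neWord_prod_eq {g : CoprodI G} (hg : g ≠ 1) :
    ∃ (i j : ι) (w : NeWord G i j), w.prod = g := by
  classical
  obtain ⟨i, j, w, hw⟩ := NeWord.of_word (Word.equiv g) (by
    intro h
    exact hg (Word.equiv.injective (h.trans (Word.equiv.apply_symm_apply Word.empty).symm)))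
  refine ⟨i, j, w, ?_⟩
  rw [NeWord.prod, hw]
  exact Word.equiv.symm_apply_apply g

/-- The number of letters of the reduced word representing an element of a free product. -/
noncomputable def syllableLength (g : CoprodI G) : ℕ := by
  classical
  exact (Word.equiv g).toList.length

theorem NeWord.syllableLength_prod {i j : ι} (w : NeWord G i j) :
    syllableLength w.prod = w.toList.length := by
  classical
  exact congrArg (fun v : Word G => v.toList.length) (Word.equiv.apply_symm_apply w.toWord)

theorem syllableLength_one : syllableLength (1 : CoprodI G) = 0 := by
  classical
  exact congrArg (fun v : Word G => v.toList.length) (Word.equiv.apply_symm_apply Word.empty)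

theorem syllableLength_of_le {i : ι} (x : G i) : syllableLength (of x) ≤ 1 := by
  by_cases hx : x = 1
  · simp [hx, syllableLength_one]
  · rw [← NeWord.prod_singleton x hx, NeWord.syllableLength_prod]
    simp

theorem syllableLength_of_mul_le {i : ι} (x : G i) (g : CoprodI G) :
    syllableLength (of x * g) ≤ syllableLength g + 1 := by
  classical
  have hlen : ∀ p : Word.Pair G i, (Word.rcons p).toList.length ≤ p.tail.toList.length + 1 ∧
      p.tail.toList.length ≤ (Word.rcons p).toList.length := by
    intro p
    unfold Word.rcons
    split_ifs <;> simp
  have h1 : syllableLength (of x * g) = ((of x * g) • (Word.empty : Word G)).toList.length := by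
    simp only [syllableLength, Word.equiv, Equiv.coe_fn_mk]
  have h2 : syllableLength g = (g • (Word.empty : Word G)).toList.length := by
    simp only [syllableLength, Word.equiv, Equiv.coe_fn_mk]
  rw [h1, h2, mul_smul, Word.of_smul_def]
  refine (hlen _).1.trans (Nat.succ_le_succ ?_)
  refine (hlen (Word.equivPair i (g • (Word.empty : Word G)))).2.trans ?_
  rw [← Word.equivPair_symm, Equiv.symm_apply_apply]

theorem NeWord.syllableLength_prod_mul_le {i j : ι} (w : NeWord G i j) (g : CoprodI G) :
    syllableLength (w.prod * g) ≤ w.toList.length + syllableLength g := by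
  induction w generalizing g with
  | singleton x hx =>
    simpa [add_comm] using syllableLength_of_mul_le x g
  | append w₁ hne w₂ ih₁ ih₂ =>
    rw [append_prod, mul_assoc, toList, List.length_append]
    linarith [ih₁ (w₂.prod * g), ih₂ g]

theorem syllableLength_mul_le (g h : CoprodI G) :
    syllableLength (g * h) ≤ syllableLength g + syllableLength h := by
  by_cases hg : g = 1
  · simp [hg]
  · obtain ⟨i, j, w, rfl⟩ := exists_neWord_prod_eq hg
    rw [w.syllableLength_prod]
    exact w.syllableLength_prod_mul_le h

theorem NeWord.eq_of_or_eq_of_mul {i j : ι} (w : NeWord G i j) :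
    (∃ x : G i, w.prod = of x) ∨ ∃ (x : G i) (k : ι) (v : NeWord G k j), k ≠ i ∧
      w.prod = of x * v.prod ∧ w.toList.length = v.toList.length + 1 := by
  induction w with
  | singleton x hx => exact Or.inl ⟨x, prod_singleton x hx⟩
  | @append i j k l w₁ hne w₂ ih₁ ih₂ =>
    right
    cases w₁ with
    | singleton x hx => exact ⟨x, k, w₂, hne.symm, by simp, by simp [add_comm]⟩
    | append u₁ hu u₂ =>
      obtain ⟨x, hx⟩ | ⟨x, m, v, hm, hv, hlen⟩ := ih₁
      · refine absurd (?_ : 2 ≤ syllableLength (of x)) (by have := syllableLength_of_le x; omega)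
        rw [← hx, syllableLength_prod, toList, List.length_append]
        have h₁ := List.length_pos_of_ne_nil u₁.toList_ne_nil
        have h₂ := List.length_pos_of_ne_nil u₂.toList_ne_nil
        omega
      · refine ⟨x, m, v.append hne w₂, hm, ?_, ?_⟩
        · rw [append_prod, hv, append_prod, mul_assoc]
        · rw [toList, List.length_append, hlen, toList, List.length_append]
          omega

theorem NeWord.length_inv {i j : ι} (w : NeWord G i j) :
    w.inv.toList.length = w.toList.length := by
  induction w with
  | singleton x hx => rfl
  | append w₁ hne w₂ ih₁ ih₂ => simp [inv, ih₁, ih₂, add_comm]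

theorem NeWord.eq_of_or_eq_mul_of {i j : ι} (w : NeWord G i j) :
    (i = j ∧ ∃ x : G j, w.prod = of x) ∨ ∃ (x : G j) (k : ι) (v : NeWord G i k), k ≠ j ∧
      w.prod = v.prod * of x ∧ w.toList.length = v.toList.length + 1 := by
  obtain ⟨x, hx⟩ | ⟨x, k, v, hk, hv, hlen⟩ := w.inv.eq_of_or_eq_of_mul
  · have hx1 : x ≠ 1 := by
      rintro rfl
      exact w.inv.prod_ne_one (by rw [hx, map_one])
    have := NeWord.snd_eq_of_prod_eq (v := singleton x hx1) (by rw [hx, prod_singleton])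
    refine Or.inl ⟨this, x⁻¹, ?_⟩
    rw [map_inv, ← hx, inv_prod, inv_inv]
  · refine Or.inr ⟨x⁻¹, k, v.inv, hk, ?_, ?_⟩
    · rw [inv_prod, map_inv, ← mul_inv_rev, ← hv, inv_prod, inv_inv]
    · rw [length_inv, ← hlen, length_inv]

/-- Every element of a free product is in the factor `G i` or becomes, after multiplication on
both sides by elements of `G i`, a reduced word neither starting nor ending in `G i`. -/
theorem mem_range_of_or_exists_neWord (i : ι) (g : CoprodI G) :
    g ∈ (of : G i →* CoprodI G).range ∨ ∃ (x y : G i) (j k : ι) (w : NeWord G j k),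
      j ≠ i ∧ k ≠ i ∧ g = of x * w.prod * of y := by
  have key : ∀ {j k : ι} (w : NeWord G j k), j ≠ i → ∃ (y : G i) (l : ι) (v : NeWord G j l),
      l ≠ i ∧ w.prod = v.prod * of y := by
    intro j k w hj
    by_cases hk : k = i
    · subst hk
      obtain ⟨h, -⟩ | ⟨y, l, v, hl, hv, -⟩ := w.eq_of_or_eq_mul_of
      · exact absurd h hj
      · exact ⟨y, l, v, hl, hv⟩
    · exact ⟨1, k, w, hk, by simp⟩
  by_cases hg : g = 1
  · exact Or.inl (hg ▸ one_mem _)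
  obtain ⟨j, k, w, rfl⟩ := exists_neWord_prod_eq hg
  by_cases hj : j = i
  · subst hj
    obtain ⟨x, hx⟩ | ⟨x, m, v, hm, hv, -⟩ := w.eq_of_or_eq_of_mul
    · exact Or.inl ⟨x, hx.symm⟩
    · obtain ⟨y, l, u, hl, hu⟩ := key v hm
      exact Or.inr ⟨x, y, m, l, u, hm, hl, by rw [hv, hu, mul_assoc]⟩
  · obtain ⟨y, l, u, hl, hu⟩ := key w hj
    exact Or.inr ⟨1, y, j, l, u, hj, hl, by simp [hu]⟩

/-- Every nontrivial element of a free product is conjugate to an element of a factor or to a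
cyclically reduced word. -/
theorem exists_conj_eq_of_or_neWord {g : CoprodI G} (hg : g ≠ 1) :
    ∃ c : CoprodI G, (∃ (i : ι) (x : G i), c * g * c⁻¹ = of x) ∨
      ∃ (i j : ι) (w : NeWord G i j), i ≠ j ∧ c * g * c⁻¹ = w.prod := by
  induction hn : syllableLength g using Nat.strong_induction_on generalizing g with
  | _ n ih =>
  subst hn
  obtain ⟨i, j, w, rfl⟩ := exists_neWord_prod_eq hg
  by_cases hij : i = j
  swap
  · exact ⟨1, Or.inr ⟨i, j, w, hij, by simp⟩⟩
  subst hij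
  obtain ⟨x, hx⟩ | ⟨x, k, v, hk, hv, hvl⟩ := w.eq_of_or_eq_of_mul
  · exact ⟨1, Or.inl ⟨i, x, by simp [hx]⟩⟩
  obtain ⟨h, -⟩ | ⟨y, l, u, hl, hu, hul⟩ := v.eq_of_or_eq_mul_of
  · exact absurd h hk
  have hconj : (of x)⁻¹ * w.prod * ((of x)⁻¹)⁻¹ = u.prod * of (y * x) := by
    rw [hv, hu, map_mul]
    group
  by_cases hyx : y * x = 1
  · rw [hyx, map_one, mul_one] at hconj
    obtain ⟨c, hc⟩ := ih (syllableLength u.prod)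
      (by rw [u.syllableLength_prod, w.syllableLength_prod]; omega) u.prod_ne_one rfl
    refine ⟨c * (of x)⁻¹, ?_⟩
    have : c * (of x)⁻¹ * w.prod * (c * (of x)⁻¹)⁻¹ = c * u.prod * c⁻¹ := by
      rw [← hconj]
      group
    rwa [this]
  · exact ⟨(of x)⁻¹, Or.inr ⟨k, i, u.append hl (NeWord.singleton (y * x) hyx), hk, by
      rw [hconj, NeWord.append_prod, NeWord.prod_singleton]⟩⟩

theorem NeWord.not_isOfFinOrder_prod {i j : ι} (w : NeWord G i j) (hij : i ≠ j) :
    ¬ IsOfFinOrder w.prod := by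
  have hpow : ∀ n : ℕ, ∃ v : NeWord G i j, v.prod = w.prod ^ (n + 1) := by
    intro n
    induction n with
    | zero => exact ⟨w, by simp⟩
    | succ n ih =>
      obtain ⟨v, hv⟩ := ih
      exact ⟨v.append hij.symm w, by rw [append_prod, hv, ← pow_succ]⟩
  rw [isOfFinOrder_iff_pow_eq_one]
  rintro ⟨n, hn, h⟩
  obtain ⟨v, hv⟩ := hpow (n - 1)
  rw [Nat.sub_add_cancel hn, h] at hv
  exact v.prod_ne_one hv

theorem not_isOfFinOrder_mul_prod {i j k : ι} {x : G i} (hx : x ≠ 1) (w : NeWord G j k)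
    (hj : j ≠ i) (hk : k ≠ i) : ¬ IsOfFinOrder (of x * w.prod) := by
  have := NeWord.not_isOfFinOrder_prod ((NeWord.singleton x hx).append hj.symm w) hk.symm
  rwa [NeWord.append_prod, NeWord.prod_singleton] at this

theorem isOfFinOrder_conj_iff {H : Type*} [Group H] (c g : H) :
    IsOfFinOrder (c * g * c⁻¹) ↔ IsOfFinOrder g :=
  Function.Injective.isOfFinOrder_iff (f := (MulAut.conj c).toMonoidHom) (MulAut.conj c).injective

/-- A torsion subgroup of a free product meeting a factor nontrivially is contained in it. -/
theorem le_range_of_isOfFinOrder {T : Subgroup (CoprodI G)} (hT : ∀ g ∈ T, IsOfFinOrder g)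
    {i : ι} {a : G i} (ha : a ≠ 1) (haT : of a ∈ T) : T ≤ (of : G i →* CoprodI G).range := by
  intro g hg
  obtain h | ⟨x, y, j, k, w, hj, hk, rfl⟩ := mem_range_of_or_exists_neWord i g
  · exact h
  exfalso
  have hcyc : ∀ b : G i, IsOfFinOrder (of b * (of x * w.prod * of y)) → y * b * x = 1 := by
    intro b hb
    by_contra hne
    refine not_isOfFinOrder_mul_prod hne w hj hk ?_
    rw [← isOfFinOrder_conj_iff (of y)] at hb
    have heq : of (y * b * x) * w.prod =
        of y * (of b * (of x * w.prod * of y)) * (of y)⁻¹ := by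
      rw [map_mul, map_mul]
      group
    rwa [heq]
  have h₁ := hcyc 1 (by simpa using hT _ hg)
  have h₂ := hcyc a (hT _ (mul_mem haT hg))
  rw [mul_one] at h₁
  rw [← h₁, mul_left_inj] at h₂
  exact ha (by simpa using h₂)

theorem mem_range_of_commute {i : ι} {a : G i} (ha : a ≠ 1) {g : CoprodI G}
    (h : Commute g (of a)) : g ∈ (of : G i →* CoprodI G).range := by
  obtain h | ⟨x, y, j, k, w, hj, hk, rfl⟩ := mem_range_of_or_exists_neWord i g
  · exact h
  exfalso
  have h₁ : y * a * y⁻¹ ≠ 1 := by simpa using ha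
  have h₂ : x⁻¹ * a⁻¹ * x ≠ 1 := by
    intro h
    apply ha
    have : a⁻¹ = x * (x⁻¹ * a⁻¹ * x) * x⁻¹ := by group
    simpa [h] using this
  refine NeWord.prod_ne_one (((w.append hk (NeWord.singleton _ h₁)).append hk.symm w.inv).append
    hj (NeWord.singleton _ h₂)) ?_
  simp only [NeWord.append_prod, NeWord.prod_singleton, NeWord.inv_prod, map_mul, map_inv]
  have h' := h.eq
  calc w.prod * (of y * of a * (of y)⁻¹) * w.prod⁻¹ * ((of x)⁻¹ * (of a)⁻¹ * of x)
      = (of x)⁻¹ * (of x * w.prod * of y * of a) * (of x * w.prod * of y)⁻¹ * (of a)⁻¹ * of x := by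
        group
    _ = 1 := by rw [h']; group

theorem NeWord.length_mul_lt {i j k : ι} (w : NeWord G i j) (v : NeWord G j k) :
    syllableLength (w.prod * v.prod) < w.toList.length + v.toList.length := by
  have hw : ∃ (g : CoprodI G) (x : G j), w.prod = g * of x ∧
      syllableLength g + 1 ≤ w.toList.length := by
    obtain ⟨-, x, hx⟩ | ⟨x, l, u, -, hu, hl⟩ := w.eq_of_or_eq_mul_of
    · exact ⟨1, x, by simp [hx], by
        rw [syllableLength_one]; exact List.length_pos_of_ne_nil w.toList_ne_nil⟩
    · exact ⟨u.prod, x, hu, by rw [u.syllableLength_prod, hl]⟩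
  have hv : ∃ (g : CoprodI G) (x : G j), v.prod = of x * g ∧
      syllableLength g + 1 ≤ v.toList.length := by
    obtain ⟨x, hx⟩ | ⟨x, l, u, -, hu, hl⟩ := v.eq_of_or_eq_of_mul
    · exact ⟨1, x, by simp [hx], by
        rw [syllableLength_one]; exact List.length_pos_of_ne_nil v.toList_ne_nil⟩
    · exact ⟨u.prod, x, hu, by rw [u.syllableLength_prod, hl]⟩
  obtain ⟨g, x, hg, hgl⟩ := hw
  obtain ⟨h, y, hh, hhl⟩ := hv
  have heq : w.prod * v.prod = g * (of (x * y) * h) := by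
    rw [hg, hh, map_mul]
    group
  have h₁ := syllableLength_mul_le g (of (x * y) * h)
  have h₂ := syllableLength_of_mul_le (x * y) h
  rw [heq]
  omega

/-- An element commuting with a cyclically reduced word is itself, up to inversion, a reduced word
with the same first and last indices. -/
theorem NeWord.exists_of_commute {i j : ι} (w : NeWord G i j) (hij : i ≠ j) {g : CoprodI G}
    (hg : g ≠ 1) (h : Commute g w.prod) :
    (∃ v : NeWord G i j, v.prod = g) ∨ ∃ v : NeWord G i j, v.prod = g⁻¹ := by
  obtain ⟨p, q, v, rfl⟩ := exists_neWord_prod_eq hg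
  have h' := h.eq
  by_cases hp : p = j
  · subst hp
    by_cases hq : q = i
    · subst hq
      exact Or.inr ⟨v.inv, inv_prod v⟩
    · have h₁ := length_mul_lt w v
      have h₂ := syllableLength_prod (v.append hq w)
      rw [append_prod, h', toList, List.length_append] at h₂
      omega
  · by_cases hq : q = i
    · subst hq
      have h₁ := length_mul_lt v w
      have h₂ := syllableLength_prod (w.append (Ne.symm hp) v)
      rw [append_prod, ← h', toList, List.length_append] at h₂
      omega
    · have heq : (v.append hq w).prod = (w.append (Ne.symm hp) v).prod := by
        rw [append_prod, append_prod, h']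
      obtain rfl := fst_eq_of_prod_eq heq
      obtain rfl := snd_eq_of_prod_eq heq
      exact Or.inl ⟨v, rfl⟩

/-- An abelian subgroup of a free product containing a cyclically reduced word is cyclic. -/
theorem NeWord.isCyclic_of_prod_mem {i j : ι} (w : NeWord G i j) (hij : i ≠ j)
    {A : Subgroup (CoprodI G)} (hA : ∀ x ∈ A, ∀ y ∈ A, x * y = y * x) (hw : w.prod ∈ A) :
    IsCyclic A := by
  classical
  have hex : ∃ n, ∃ v : NeWord G i j, v.prod ∈ A ∧ v.toList.length = n := ⟨_, w, hw, rfl⟩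
  obtain ⟨u, huA, hu⟩ := Nat.find_spec hex
  have hmin : ∀ v : NeWord G i j, v.prod ∈ A → u.toList.length ≤ v.toList.length := by
    intro v hv
    rw [hu]
    exact Nat.find_min' hex ⟨v, hv, rfl⟩
  have hlen : ∀ v₁ v₂ v₃ : NeWord G i j, v₁.prod = v₂.prod * v₃.prod →
      v₁.toList.length = v₂.toList.length + v₃.toList.length := by
    intro v₁ v₂ v₃ h
    rw [← append_prod (hne := hij.symm)] at h
    rw [← List.length_append, ← syllableLength_prod v₁, h, syllableLength_prod, toList]
  have hpos : ∀ v : NeWord G i j, 0 < v.toList.length :=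
    fun v => List.length_pos_of_ne_nil v.toList_ne_nil
  have hmem : ∀ (n : ℕ) (v : NeWord G i j), v.toList.length = n → v.prod ∈ A →
      v.prod ∈ Subgroup.zpowers u.prod := by
    intro n
    induction n using Nat.strong_induction_on with
    | _ n ih =>
    rintro v rfl hvA
    have hmulA : u.prod⁻¹ * v.prod ∈ A := mul_mem (inv_mem huA) hvA
    by_cases h1 : u.prod⁻¹ * v.prod = 1
    · rw [inv_mul_eq_one] at h1
      rw [← h1]
      exact Subgroup.mem_zpowers _
    obtain ⟨t, ht⟩ | ⟨t, ht⟩ := w.exists_of_commute hij h1 (hA _ hmulA _ hw)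
    · have hv : v.prod = u.prod * t.prod := by rw [ht, mul_inv_cancel_left]
      rw [hv]
      refine mul_mem (Subgroup.mem_zpowers _) (ih _ ?_ t rfl (ht ▸ hmulA))
      have := hlen _ _ _ hv
      have := hpos u
      omega
    · have hu' : u.prod = v.prod * t.prod := by rw [ht]; group
      have := hlen _ _ _ hu'
      have := hpos t
      have := hmin v hvA
      omega
  refine Subgroup.isCyclic_iff_exists_zpowers_eq_top A |>.2 ⟨u.prod, ?_⟩
  refine le_antisymm ((Subgroup.zpowers_le).2 huA) fun g hg => ?_
  by_cases hg1 : g = 1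
  · exact hg1 ▸ one_mem _
  obtain ⟨v, hv⟩ | ⟨v, hv⟩ := w.exists_of_commute hij hg1 (hA _ hg _ hw)
  · exact hv ▸ hmem _ v rfl (hv ▸ hg)
  · exact inv_mem_iff.1 (hv ▸ hmem _ v rfl (hv ▸ inv_mem hg))

end NeWord

end Monoid.CoprodI

universe v

theorem IsDirectSumOfCyclic.of_mulEquiv {A : Type v} {B : Type (max u v)} [Group A] [Group B]
    (e : A ≃* B) (h : IsDirectSumOfCyclic A) : IsDirectSumOfCyclic B := by
  obtain ⟨ι, n, ⟨f⟩⟩ := h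
  exact ⟨ULift.{u} ι, fun i => n i.down, ⟨(e.symm.trans f).trans
    (AddEquiv.toMultiplicative (DirectSum.equivCongrLeft Equiv.ulift.symm))⟩⟩

theorem IsCyclic.isDirectSumOfCyclic {A : Type*} [Group A] (h : IsCyclic A) :
    IsDirectSumOfCyclic A :=
  ⟨PUnit, fun _ => Nat.card A, ⟨(zmodCyclicMulEquiv h).symm.trans
    (AddEquiv.toMultiplicative (DirectSum.id (ZMod (Nat.card A)) PUnit).symm)⟩⟩

/-- The class `𝒢` is closed under arbitrary coproducts (free products). -/
theorem classG_coprod {J : Type*} (G : J → Type*) [∀ j, Group (G j)]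
    (hG : ∀ j, InClassG (G j)) : InClassG (Monoid.CoprodI G) := by
  open Monoid.CoprodI in
  constructor
  · intro T hT
    by_cases hbot : T = ⊥
    · simp [hbot]
    obtain ⟨g, hgT, hg1⟩ := T.bot_or_exists_ne_one.resolve_left hbot
    obtain ⟨c, ⟨i, x, hx⟩ | ⟨i, j, w, hij, hw⟩⟩ := exists_conj_eq_of_or_neWord hg1
    · let S := T.map (MulAut.conj c).toMonoidHom
      have hS : ∀ s ∈ S, IsOfFinOrder s := by
        rintro _ ⟨t, ht, rfl⟩
        exact (isOfFinOrder_conj_iff c t).2 (hT t ht)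
      have hxS : of x ∈ S := ⟨g, hgT, hx⟩
      have hx1 : x ≠ 1 := by
        rintro rfl
        exact hg1 (by simpa using hx)
      have hle := le_range_of_isOfFinOrder hS hx1 hxS
      have hfin : (S : Set (Monoid.CoprodI G)).Finite := by
        have hpre := (hG i).1 (S.comap of) fun y hy =>
          (of_injective i).isOfFinOrder_iff.1 (hS _ hy)
        refine (hpre.image of).subset fun s hs => ?_
        obtain ⟨y, rfl⟩ := hle hs
        exact ⟨y, hs, rfl⟩
      exact Set.Finite.of_finite_image hfin (MulAut.conj c).injective.injOn
    · exact absurd ((isOfFinOrder_conj_iff c g).2 (hT g hgT))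
        (hw ▸ w.not_isOfFinOrder_prod hij)
  · intro A hA
    by_cases hbot : A = ⊥
    · subst hbot
      exact IsCyclic.isDirectSumOfCyclic inferInstance
    obtain ⟨g, hgA, hg1⟩ := A.bot_or_exists_ne_one.resolve_left hbot
    obtain ⟨c, hc⟩ := exists_conj_eq_of_or_neWord hg1
    let S := A.map (MulAut.conj c).toMonoidHom
    have hS : ∀ x ∈ S, ∀ y ∈ S, x * y = y * x := by
      rintro _ ⟨x, hx, rfl⟩ _ ⟨y, hy, rfl⟩
      rw [← map_mul, hA x hx y hy, map_mul]
    let e : A ≃* S := A.equivMapOfInjective _ (MulAut.conj c).injective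
    have hgS : c * g * c⁻¹ ∈ S := ⟨g, hgA, rfl⟩
    obtain ⟨i, x, hx⟩ | ⟨i, j, w, hij, hw⟩ := hc
    · rw [hx] at hgS
      have hx1 : x ≠ 1 := by
        rintro rfl
        exact hg1 (by simpa using hx)
      have hle : S ≤ (of : G i →* Monoid.CoprodI G).range :=
        fun s hs => mem_range_of_commute hx1 (hS s hs _ hgS)
      have hmap : (S.comap (of : G i →* Monoid.CoprodI G)).map of = S :=
        Subgroup.map_comap_eq_self hle
      have hcomap := (hG i).2 (S.comap of) fun y hy z hz =>
        of_injective i (by rw [map_mul, map_mul]; exact hS _ hy _ hz)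
      let f := (S.comap (of : G i →* Monoid.CoprodI G)).equivMapOfInjective of (of_injective i)
      exact IsDirectSumOfCyclic.of_mulEquiv.{max u_1 u_2, u_2} ((f.trans (MulEquiv.subgroupCongr hmap)).trans e.symm) hcomap
    · rw [hw] at hgS
      have := w.isCyclic_of_prod_mem hij hS hgS
      exact IsCyclic.isDirectSumOfCyclic (isCyclic_of_surjective e.symm e.symm.surjective)
end

section
/- Let Γ = (V, E) be a finite simplicial graph and let A_Γ be the right-angled Artin group on Γ. Then every abelian subgroup of A_Γ is finitely generated. -/
/-- The right-angled Artin group on a simplicial graph `Γ`: the quotient of the free group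
on the vertices by the normal closure of the commutators `[v, w]` for edges `{v, w}`. -/
abbrev RAAG {V : Type*} (Γ : SimpleGraph V) : Type _ :=
  FreeGroup V ⧸ Subgroup.normalClosure
    {x | ∃ v w : V, Γ.Adj v w ∧
      x = FreeGroup.of v * FreeGroup.of w * (FreeGroup.of v)⁻¹ * (FreeGroup.of w)⁻¹}

/-- Every abelian subgroup of `G` is finitely generated. -/
def AbelianSubgroupsFG (G : Type*) [Group G] : Prop :=
  ∀ A : Subgroup G, (∀ x ∈ A, ∀ y ∈ A, x * y = y * x) → A.FG

namespace AbelianSubgroupsFG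

variable {G H : Type*} [Group G] [Group H]

theorem of_injective (f : G →* H) (hf : Function.Injective f) (hH : AbelianSubgroupsFG H) :
    AbelianSubgroupsFG G := by
  intro A hA
  have hB : (A.map f).FG := by
    refine hH _ ?_
    rintro _ ⟨x, hx, rfl⟩ _ ⟨y, hy, rfl⟩
    rw [← map_mul, ← map_mul, hA x hx y hy]
  rw [← Group.fg_iff_subgroup_fg] at hB ⊢
  exact Group.fg_of_surjective (f := (A.equivMapOfInjective f hf).symm.toMonoidHom)
    (A.equivMapOfInjective f hf).symm.surjective

theorem of_ker (f : G →* H) (hH : AbelianSubgroupsFG H) (hK : AbelianSubgroupsFG f.ker) :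
    AbelianSubgroupsFG G := by
  intro A hA
  obtain ⟨T, hT⟩ : (A.map f).FG := by
    refine hH _ ?_
    rintro _ ⟨x, hx, rfl⟩ _ ⟨y, hy, rfl⟩
    rw [← map_mul, ← map_mul, hA x hx y hy]
  obtain ⟨S, hS⟩ : (A.subgroupOf f.ker).FG :=
    hK _ fun x hx y hy => Subtype.ext (hA x hx y hy)
  have hTA : ∀ t : T, ∃ a ∈ A, f a = t := fun t => by
    have : (t : H) ∈ A.map f := hT ▸ Subgroup.subset_closure t.2
    exact this
  choose s hsA hs using hTA
  have hfin : (Subtype.val '' (S : Set f.ker) ∪ Set.range s).Finite :=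
    (S.finite_toSet.image _).union (Set.finite_range s)
  refine (Subgroup.fg_iff A).2 ⟨_, le_antisymm ?_ fun a ha => ?_, hfin⟩
  · rw [Subgroup.closure_le]
    rintro _ (⟨x, hx, rfl⟩ | ⟨t, rfl⟩)
    · have : x ∈ A.subgroupOf f.ker := hS ▸ Subgroup.subset_closure hx
      exact this
    · exact hsA t
  · have hle : A.map f ≤ (Subgroup.closure (Set.range s)).map f := by
      rw [← hT, Subgroup.closure_le]
      exact fun t ht => ⟨s ⟨t, ht⟩, Subgroup.subset_closure ⟨_, rfl⟩, hs _⟩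
    obtain ⟨c, hc, hca⟩ := hle ⟨a, ha, rfl⟩
    have hcA : c ∈ A := by
      refine (Subgroup.closure_le A).2 ?_ hc
      rintro _ ⟨t, rfl⟩
      exact hsA t
    have hker : a * c⁻¹ ∈ f.ker := by simp [MonoidHom.mem_ker, hca]
    have hmem : (⟨a * c⁻¹, hker⟩ : f.ker) ∈ Subgroup.closure (S : Set f.ker) := by
      rw [hS]
      exact A.mul_mem ha (A.inv_mem hcA)
    have hmem' : a * c⁻¹ ∈ Subgroup.closure (Subtype.val '' (S : Set f.ker)) := by
      have := Subgroup.mem_map_of_mem f.ker.subtype hmem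
      rwa [MonoidHom.map_closure] at this
    rw [← inv_mul_cancel_right a c]
    exact mul_mem (Subgroup.closure_mono Set.subset_union_left hmem')
      (Subgroup.closure_mono Set.subset_union_right hc)

theorem of_isFreeGroup [IsFreeGroup G] : AbelianSubgroupsFG G := by
  intro A hA
  have hsub : Subsingleton (IsFreeGroup.Generators A) := by
    refine ⟨fun a b => ?_⟩
    have hcomm : IsFreeGroup.of a * IsFreeGroup.of b = IsFreeGroup.of b * IsFreeGroup.of a :=
      Subtype.ext (hA _ (IsFreeGroup.of a).2 _ (IsFreeGroup.of b).2)
    by_contra hab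
    classical
    let f := IsFreeGroup.lift fun c : IsFreeGroup.Generators A =>
      if c = a then Equiv.swap (0 : Fin 3) 1 else Equiv.swap 1 2
    have := congrArg f hcomm
    simp only [map_mul, f, IsFreeGroup.lift_of, if_neg (Ne.symm hab), if_true] at this
    exact absurd this (by decide)
  rw [← Group.fg_iff_subgroup_fg]
  exact Group.fg_of_surjective (f := (IsFreeGroup.mulEquiv A).toMonoidHom)
    (IsFreeGroup.mulEquiv A).surjective

theorem semidirectProduct {φ : H →* MulAut G} (hG : AbelianSubgroupsFG G)
    (hH : AbelianSubgroupsFG H) : AbelianSubgroupsFG (G ⋊[φ] H) := by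
  refine of_ker SemidirectProduct.rightHom hH ?_
  rw [← SemidirectProduct.range_inl_eq_ker_rightHom]
  exact of_injective (MonoidHom.ofInjective SemidirectProduct.inl_injective).symm.toMonoidHom
    (MulEquiv.injective _) hG

end AbelianSubgroupsFG

/-- The action of `G` on the free group on a `G`-set, permuting the basis. -/
def FreeGroup.permAut (G X : Type*) [Group G] [MulAction G X] : G →* MulAut (FreeGroup X) where
  toFun g := FreeGroup.freeGroupCongr (MulAction.toPerm g)
  map_one' := by
    ext x
    induction x using FreeGroup.induction_on <;> simp_all
  map_mul' g h := by
    ext x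
    induction x using FreeGroup.induction_on <;> simp_all [mul_smul]

@[simp]
theorem FreeGroup.permAut_of {G X : Type*} [Group G] [MulAction G X] (g : G) (x : X) :
    FreeGroup.permAut G X g (FreeGroup.of x) = FreeGroup.of (g • x) := by
  simp [FreeGroup.permAut]

/-- The map `G ⧸ H → K` sending the coset of `g` to the conjugate of `t` by `i g`, for `t`
commuting with the image of `H` under `i`. -/
def cosetConj {G K : Type*} [Group G] [Group K] (H : Subgroup G) (i : G →* K) (t : K)
    (ht : ∀ h ∈ H, i h * t = t * i h) (q : G ⧸ H) : K :=
  Quotient.liftOn' q (fun g => i g * t * (i g)⁻¹) fun a b hab => by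
    have h := ht _ (QuotientGroup.leftRel_apply.1 hab)
    obtain ⟨c, rfl⟩ : ∃ c, b = a * c := ⟨a⁻¹ * b, by group⟩
    rw [inv_mul_cancel_left] at h
    simp only [map_mul, mul_inv_rev]
    rw [mul_assoc (i a) (i c) t, h]
    group

theorem cosetConj_mk {G K : Type*} [Group G] [Group K] (H : Subgroup G) (i : G →* K) (t : K)
    (ht : ∀ h ∈ H, i h * t = t * i h) (g : G) :
    cosetConj H i t ht (g : G ⧸ H) = i g * t * (i g)⁻¹ :=
  rfl

/-- The homomorphism `F(G ⧸ H) ⋊ G →* K` extending `i : G →* K` and sending the trivial coset to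
an element `t` that commutes with the image of `H`. -/
def cosetSemidirectLift {G K : Type*} [Group G] [Group K] (H : Subgroup G) (i : G →* K) (t : K)
    (ht : ∀ h ∈ H, i h * t = t * i h) :
    FreeGroup (G ⧸ H) ⋊[FreeGroup.permAut G (G ⧸ H)] G →* K :=
  SemidirectProduct.lift (FreeGroup.lift (cosetConj H i t ht)) i fun g => by
    refine FreeGroup.ext_hom _ _ fun q => ?_
    induction q using QuotientGroup.induction_on with
    | H a =>
      simp only [MonoidHom.comp_apply, MulEquiv.coe_toMonoidHom, FreeGroup.permAut_of,
        FreeGroup.lift_apply_of, MulAut.conj_apply, cosetConj_mk]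
      change i (g * a) * t * (i (g * a))⁻¹ = _
      rw [map_mul]
      group

theorem cosetSemidirectLift_inr {G K : Type*} [Group G] [Group K] (H : Subgroup G) (i : G →* K)
    (t : K) (ht : ∀ h ∈ H, i h * t = t * i h) (g : G) :
    cosetSemidirectLift H i t ht (SemidirectProduct.inr g) = i g := by
  simp [cosetSemidirectLift]

theorem cosetSemidirectLift_inl_of_one {G K : Type*} [Group G] [Group K] (H : Subgroup G)
    (i : G →* K) (t : K) (ht : ∀ h ∈ H, i h * t = t * i h) :
    cosetSemidirectLift H i t ht
      (SemidirectProduct.inl (FreeGroup.of ((1 : G) : G ⧸ H))) = t := by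
  rw [cosetSemidirectLift, SemidirectProduct.lift_inl, FreeGroup.lift_apply_of, cosetConj_mk]
  simp

namespace RAAG

variable {V W : Type*} {Γ : SimpleGraph V} {Δ : SimpleGraph W} {G : Type*} [Group G]

/-- The generator of the right-angled Artin group at a vertex. -/
def of (Γ : SimpleGraph V) (v : V) : RAAG Γ := QuotientGroup.mk (FreeGroup.of v)

theorem of_mul_of_comm {v w : V} (h : Γ.Adj v w) : of Γ v * of Γ w = of Γ w * of Γ v := by
  have : (QuotientGroup.mk (FreeGroup.of v * FreeGroup.of w * (FreeGroup.of v)⁻¹ *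
      (FreeGroup.of w)⁻¹) : RAAG Γ) = 1 :=
    (QuotientGroup.eq_one_iff _).2 (Subgroup.subset_normalClosure ⟨v, w, h, rfl⟩)
  have h' : of Γ v * of Γ w * (of Γ v)⁻¹ * (of Γ w)⁻¹ = 1 := this
  rw [mul_inv_eq_one, mul_inv_eq_iff_eq_mul] at h'
  exact h'

/-- The universal property of the right-angled Artin group. -/
def lift (f : V → G) (hf : ∀ v w, Γ.Adj v w → f v * f w = f w * f v) : RAAG Γ →* G :=
  QuotientGroup.lift _ (FreeGroup.lift f) <| Subgroup.normalClosure_le_normal <| by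
    rintro _ ⟨v, w, h, rfl⟩
    simp [MonoidHom.mem_ker, hf v w h]

@[simp]
theorem lift_of (f : V → G) (hf : ∀ v w, Γ.Adj v w → f v * f w = f w * f v) (v : V) :
    lift f hf (of Γ v) = f v := by
  change FreeGroup.lift f (FreeGroup.of v) = f v
  simp

theorem hom_ext {f g : RAAG Γ →* G} (h : ∀ v, f (of Γ v) = g (of Γ v)) : f = g :=
  QuotientGroup.monoidHom_ext _ (FreeGroup.ext_hom _ _ h)

/-- The homomorphism of right-angled Artin groups induced by a graph homomorphism. -/
def map (f : Γ →g Δ) : RAAG Γ →* RAAG Δ :=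
  lift (fun v => of Δ (f v)) fun _ _ h => of_mul_of_comm (f.map_adj h)

@[simp]
theorem map_of (f : Γ →g Δ) (v : V) : map f (of Γ v) = of Δ (f v) := lift_of _ _ v

theorem abelianSubgroupsFG_of_iso (e : Γ ≃g Δ) (h : AbelianSubgroupsFG (RAAG Δ)) :
    AbelianSubgroupsFG (RAAG Γ) := by
  refine h.of_injective (map e.toHom) ?_
  have : (map e.symm.toHom).comp (map e.toHom) = MonoidHom.id _ := hom_ext fun v => by simp
  exact Function.LeftInverse.injective (g := map e.symm.toHom) (DFunLike.congr_fun this)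

theorem abelianSubgroupsFG_option {Γ : SimpleGraph (Option V)}
    (h : AbelianSubgroupsFG (RAAG (Γ.comap some))) : AbelianSubgroupsFG (RAAG Γ) := by
  let i : RAAG (Γ.comap some) →* RAAG Γ := map ⟨some, id⟩
  let L : Subgroup (RAAG (Γ.comap some)) :=
    Subgroup.closure {x | ∃ w, Γ.Adj none (some w) ∧ x = of _ w}
  have hL : ∀ x ∈ L, i x * of Γ none = of Γ none * i x := by
    intro x hx
    suffices L ≤ (Subgroup.centralizer {of Γ none}).comap i from
      (Subgroup.mem_centralizer_singleton_iff.1 (this hx))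
    rw [Subgroup.closure_le]
    rintro _ ⟨w, hw, rfl⟩
    refine Subgroup.mem_centralizer_singleton_iff.2 ?_
    rw [map_of]
    exact of_mul_of_comm hw.symm
  let S := FreeGroup (RAAG (Γ.comap some) ⧸ L) ⋊[FreeGroup.permAut _ (RAAG (Γ.comap some) ⧸ L)]
    RAAG (Γ.comap some)
  let t : S := SemidirectProduct.inl (FreeGroup.of ((1 : RAAG (Γ.comap some)) : _ ⧸ L))
  have hcomm : ∀ w, Γ.Adj none (some w) →
      t * SemidirectProduct.inr (of _ w) = SemidirectProduct.inr (of _ w) * t := by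
    intro w hw
    symm
    rw [← mul_inv_eq_iff_eq_mul, ← map_inv, ← SemidirectProduct.inl_aut,
      FreeGroup.permAut_of]
    congr 2
    refine QuotientGroup.eq.2 ?_
    have hwL : of (Γ.comap some) w ∈ L := Subgroup.subset_closure ⟨w, hw, rfl⟩
    simpa using hwL
  let f : RAAG Γ →* S :=
    lift (fun v => v.elim t fun w => SemidirectProduct.inr (of _ w)) <| by
      rintro (_ | v) (_ | w) hvw
      · rfl
      · exact hcomm w hvw
      · exact (hcomm v hvw.symm).symm
      · simp only [Option.elim_some, ← map_mul]
        rw [of_mul_of_comm (Γ := Γ.comap some) hvw]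
  refine (AbelianSubgroupsFG.semidirectProduct .of_isFreeGroup h).of_injective f ?_
  have hf : (cosetSemidirectLift L i (of Γ none) hL).comp f = MonoidHom.id _ := by
    refine hom_ext ?_
    rintro (_ | v)
    · simp [f, t, -QuotientGroup.mk_one, cosetSemidirectLift_inl_of_one]
    · simp [f, cosetSemidirectLift_inr, i]
      rfl
  exact Function.LeftInverse.injective (g := cosetSemidirectLift L i (of Γ none) hL)
    (DFunLike.congr_fun hf)

theorem abelianSubgroupsFG [Finite V] (Γ : SimpleGraph V) : AbelianSubgroupsFG (RAAG Γ) := by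
  induction V using Finite.induction_empty_option with
  | of_equiv e ih => exact abelianSubgroupsFG_of_iso (SimpleGraph.Iso.comap e Γ).symm (ih _)
  | h_empty =>
    exact AbelianSubgroupsFG.of_injective (H := FreeGroup Empty) (lift (fun v => v.elim) nofun)
      (fun x y _ => by
        induction x using QuotientGroup.induction_on
        induction y using QuotientGroup.induction_on
        exact congrArg _ (Subsingleton.elim _ _)) .of_isFreeGroup
  | h_option ih => exact abelianSubgroupsFG_option (ih _)

end RAAG

/-- Every abelian subgroup of a right-angled Artin group on a finite simplicial graph is
finitely generated. -/
theorem RAAG_abelian_subgroup_fg {V : Type*} [Finite V] (Γ : SimpleGraph V)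
    (A : Subgroup (RAAG Γ)) (hA : ∀ x ∈ A, ∀ y ∈ A, x * y = y * x) :
    A.FG :=
  RAAG.abelianSubgroupsFG Γ A hA
end

section
/- For every n ≥ 1, the group GL_n(ℤ) of invertible n × n integer matrices belongs to the class 𝒢: every torsion subgroup of GL_n(ℤ) is finite, and every abelian subgroup of GL_n(ℤ) is finitely generated (hence a direct sum of cyclic groups). -/
universe u

theorem exists_one_add_pow_eq {R : Type*} [Ring R] (x : R) (n : ℕ) :
    ∃ z, (1 + x) ^ n = 1 + (n : ℤ) • x + x * x * z := by
  induction n with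
  | zero => exact ⟨0, by simp⟩
  | succ n ih =>
    obtain ⟨z, hz⟩ := ih
    refine ⟨z + (n : ℤ) • 1 + z * x, ?_⟩
    rw [pow_succ, hz]
    push_cast
    simp only [add_smul, one_smul, mul_add, add_mul, mul_one, one_mul, smul_mul_assoc,
      mul_smul_comm, mul_assoc]
    abel

/-- If `1 + 3 ^ k • y` has finite order prime to `3`, then `y` is divisible by `3`. -/
theorem exists_eq_three_smul_of_pow_eq_one {R : Type*} [Ring R] [IsAddTorsionFree R] {n k : ℕ}
    (hk : k ≠ 0) {y : R} (hn : ¬ 3 ∣ n) (h : (1 + (3 ^ k : ℤ) • y) ^ n = 1) :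
    ∃ w, y = (3 : ℤ) • w := by
  obtain ⟨z, hz⟩ := exists_one_add_pow_eq ((3 ^ k : ℤ) • y) n
  obtain ⟨j, rfl⟩ := Nat.exists_eq_succ_of_ne_zero hk
  have key : (3 ^ (j + 1) : ℤ) • ((n : ℤ) • y + (3 : ℤ) • (3 ^ j : ℤ) • (y * y * z)) = 0 := by
    rw [h] at hz
    rw [add_assoc, left_eq_add] at hz
    rw [← hz]
    simp only [smul_add, smul_smul, smul_mul_assoc, mul_smul_comm, Nat.succ_eq_add_one]
    ring_nf
  have key' := (smul_eq_zero.mp key).resolve_left (by positivity)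
  have hcop : IsCoprime (3 : ℤ) n := by
    exact_mod_cast (Nat.isCoprime_iff_coprime).mpr ((Nat.prime_three.coprime_iff_not_dvd).mpr hn)
  obtain ⟨a, b, hab⟩ := hcop
  refine ⟨a • y - b • (3 ^ j : ℤ) • (y * y * z), ?_⟩
  have hny := eq_neg_of_add_eq_zero_left key'
  calc y = (a * 3 + b * n) • y := by rw [hab, one_smul]
    _ = a • (3 : ℤ) • y + b • (n : ℤ) • y := by rw [add_smul, mul_smul, mul_smul]
    _ = _ := by
      rw [hny, smul_sub, smul_neg, smul_comm a, smul_comm b (3 : ℤ), sub_eq_add_neg]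

/-- If `1 + 3 ^ k • y` has order dividing `3` and `k ≠ 0`, then `y` is divisible by `3`. -/
theorem exists_eq_three_smul_of_pow_three_eq_one {R : Type*} [Ring R] [IsAddTorsionFree R] {k : ℕ}
    (hk : k ≠ 0) {y : R} (h : (1 + (3 ^ k : ℤ) • y) ^ 3 = 1) :
    ∃ w, y = (3 : ℤ) • w := by
  obtain ⟨j, rfl⟩ := Nat.exists_eq_succ_of_ne_zero hk
  refine ⟨-((3 ^ j : ℤ) • (y * y) + (3 ^ (2 * j) : ℤ) • (y * y * y)), ?_⟩
  have hexp : (1 + (3 ^ (j + 1) : ℤ) • y) ^ 3 = 1 + (3 ^ (j + 2) : ℤ) •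
      (y + (3 : ℤ) • ((3 ^ j : ℤ) • (y * y) + (3 ^ (2 * j) : ℤ) • (y * y * y))) := by
    simp only [pow_succ _ 2, pow_two (1 + (3 ^ (j + 1) : ℤ) • y), mul_add, add_mul, mul_one,
      one_mul, smul_mul_assoc, mul_smul_comm, smul_smul, smul_add]
    module
  rw [Nat.succ_eq_add_one, hexp, add_eq_left] at h
  have := (smul_eq_zero.mp h).resolve_left (by positivity)
  rw [smul_neg]
  exact eq_neg_of_add_eq_zero_left this

theorem Matrix.eq_zero_of_forall_exists_eq_pow_smul {m n : Type*} {X : Matrix m n ℤ}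
    (h : ∀ k : ℕ, ∃ Y : Matrix m n ℤ, X = (3 ^ k : ℤ) • Y) : X = 0 := by
  ext i j
  obtain ⟨Y, hY⟩ := h (X i j).natAbs
  refine Int.eq_zero_of_abs_lt_dvd (m := 3 ^ (X i j).natAbs) ⟨Y i j, ?_⟩ ?_
  · simpa using congrFun (congrFun hY i) j
  · rw [Int.abs_eq_natAbs]
    exact_mod_cast Nat.lt_pow_self (by norm_num)

theorem Matrix.eq_zero_of_three_smul_descent {n : Type*} {X : Matrix n n ℤ}
    (h0 : ∃ Y : Matrix n n ℤ, X = (3 : ℤ) • Y)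
    (h : ∀ (k : ℕ) (Y : Matrix n n ℤ), k ≠ 0 → X = (3 ^ k : ℤ) • Y →
      ∃ Z : Matrix n n ℤ, Y = (3 : ℤ) • Z) : X = 0 := by
  have succ (k : ℕ) : ∃ Y : Matrix n n ℤ, X = (3 ^ (k + 1) : ℤ) • Y := by
    induction k with
    | zero => simpa using h0
    | succ k ih =>
      obtain ⟨Y, hY⟩ := ih
      obtain ⟨Z, rfl⟩ := h _ Y k.succ_ne_zero hY
      exact ⟨Z, by rw [hY, smul_smul, pow_succ _ (k + 1)]⟩
  refine eq_zero_of_forall_exists_eq_pow_smul fun k => ?_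
  obtain ⟨Y, hY⟩ := succ k
  exact ⟨(3 : ℤ) • Y, by rw [hY, smul_smul, pow_succ]⟩

/-- An integer matrix of finite order congruent to `1` modulo `3` is the identity. -/
theorem Matrix.eq_one_of_pow_eq_one_of_map_eq_one {n : Type*} [Fintype n] [DecidableEq n] {m : ℕ}
    (hm : m ≠ 0) {g : Matrix n n ℤ} (hg : (Int.castRingHom (ZMod 3)).mapMatrix g = 1)
    (h : g ^ m = 1) : g = 1 := by
  have : IsAddTorsionFree (Matrix n n ℤ) := inferInstanceAs (IsAddTorsionFree (n → n → ℤ))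
  induction m using Nat.strong_induction_on generalizing g with
  | _ m ih =>
  have hdvd {g : Matrix n n ℤ} (hg : (Int.castRingHom (ZMod 3)).mapMatrix g = 1) :
      ∃ Y : Matrix n n ℤ, g - 1 = (3 : ℤ) • Y := by
    have h0 : (Int.castRingHom (ZMod 3)).mapMatrix (g - 1) = 0 := by
      rw [map_sub, hg, map_one, sub_self]
    have hd (i j : n) : (3 : ℤ) ∣ (g - 1) i j :=
      (ZMod.intCast_zmod_eq_zero_iff_dvd _ 3).mp (congrFun (congrFun h0 i) j)
    choose Y hY using hd
    exact ⟨Matrix.of Y, by ext i j; exact hY i j⟩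
  by_cases h3 : 3 ∣ m
  · obtain ⟨l, rfl⟩ := h3
    have hl : l ≠ 0 := by omega
    have hgl : (Int.castRingHom (ZMod 3)).mapMatrix (g ^ l) = 1 := by rw [map_pow, hg, one_pow]
    have hl1 : g ^ l = 1 := by
      refine sub_eq_zero.mp (eq_zero_of_three_smul_descent (hdvd hgl) fun k Y hk hY => ?_)
      refine exists_eq_three_smul_of_pow_three_eq_one hk ?_
      rw [← hY, add_sub_cancel, ← pow_mul, mul_comm, h]
    exact ih l (by omega) hl hg hl1
  · refine sub_eq_zero.mp (eq_zero_of_three_smul_descent (hdvd hg) fun k Y hk hY => ?_)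
    refine exists_eq_three_smul_of_pow_eq_one hk h3 ?_
    rw [← hY, add_sub_cancel, h]

theorem Matrix.GeneralLinearGroup.finite_of_forall_isOfFinOrder {n : Type*} [Fintype n]
    [DecidableEq n] (T : Subgroup (GL n ℤ)) (hT : ∀ x ∈ T, IsOfFinOrder x) :
    (T : Set (GL n ℤ)).Finite := by
  have : Finite (GL n (ZMod 3)) := inferInstance
  let f : GL n ℤ →* GL n (ZMod 3) := Matrix.GeneralLinearGroup.map (Int.castRingHom (ZMod 3))
  refine Set.Finite.of_finite_image (f := f) (Set.toFinite _) fun x hx y hy hxy => ?_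
  have hmem : x * y⁻¹ ∈ T := T.mul_mem hx (T.inv_mem hy)
  obtain ⟨m, hm, hpow⟩ := isOfFinOrder_iff_pow_eq_one.mp (hT _ hmem)
  have hf : f (x * y⁻¹) = 1 := by rw [map_mul, map_inv, hxy, mul_inv_cancel]
  refine mul_inv_eq_one.mp (Units.ext ?_)
  exact Matrix.eq_one_of_pow_eq_one_of_map_eq_one hm.ne' (congrArg Units.val hf)
    (by rw [← Units.val_pow_eq_pow_val, hpow, Units.val_one])

theorem isNoetherian_additive_of_injective {G H : Type*} [CommGroup G] [CommGroup H] (f : G →* H)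
    (hf : Function.Injective f) [IsNoetherian ℤ (Additive H)] : IsNoetherian ℤ (Additive G) :=
  isNoetherian_of_injective (MonoidHom.toAdditive f).toIntLinearMap hf

/-- The units of an order in a number field form a finitely generated group. -/
theorem isNoetherian_additive_units_of_isDomain (D : Type*) [CommRing D] [IsDomain D]
    [Module.Finite ℤ D] : IsNoetherian ℤ (Additive Dˣ) := by
  obtain ⟨p, hp⟩ := CharP.exists D
  rcases Nat.eq_zero_or_pos p with rfl | hpos
  · have : CharZero D := CharP.charP_to_charZero D
    let K := FractionRing D
    let : Algebra ℤ K := Ring.toIntAlgebra K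
    have : CharZero K := charZero_of_injective_algebraMap (IsFractionRing.injective D K)
    have : NumberField K :=
      { to_finiteDimensional := Module.Finite.of_isLocalization ℤ D (nonZeroDivisors ℤ) }
    have hintegral (x : D) : IsIntegral ℤ (algebraMap D K x) :=
      (Algebra.IsIntegral.isIntegral x).map (IsScalarTower.toAlgHom ℤ D K)
    let f : D →* NumberField.RingOfIntegers K :=
      NumberField.RingOfIntegers.restrict_monoidHom (algebraMap D K : D →* K) hintegral
    have hf : Function.Injective f := fun x y hxy =>
      IsFractionRing.injective D K (congrArg (algebraMap (NumberField.RingOfIntegers K) K) hxy)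
    exact isNoetherian_additive_of_injective (Units.map f) (Units.map_injective hf)
  · have : NeZero p := ⟨hpos.ne'⟩
    let : Algebra (ZMod p) D := ZMod.algebra D p
    have : Module.Finite (ZMod p) D := Module.Finite.of_restrictScalars_finite ℤ (ZMod p) D
    have : Finite D := Module.finite_of_finite (ZMod p)
    infer_instance

/-- If the kernels of `f : R →+* S` and `g : R →+* T` have product zero, then the unit group of `R`
is finitely generated as soon as those of `S` and `T` are. -/
theorem isNoetherian_additive_units_of_ker_mul_ker {R S T : Type*} [CommRing R] [CommRing S]
    [CommRing T] [Module.Finite ℤ R] (f : R →+* S) (g : R →+* T)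
    (hfg : ∀ a b, f a = 0 → g b = 0 → a * b = 0) [IsNoetherian ℤ (Additive Sˣ)]
    [IsNoetherian ℤ (Additive Tˣ)] : IsNoetherian ℤ (Additive Rˣ) := by
  have : IsNoetherian ℤ R := isNoetherian_of_isNoetherianRing_of_finite ℤ R
  let φ : Additive Rˣ →ₗ[ℤ] Additive Sˣ × Additive Tˣ :=
    ((MonoidHom.toAdditive (Units.map (f : R →* S))).toIntLinearMap).prod
      ((MonoidHom.toAdditive (Units.map (g : R →* T))).toIntLinearMap)
  have hker (u : LinearMap.ker φ) :
      f ((u.1.toMul : R) - 1) = 0 ∧ g ((u.1.toMul : R) - 1) = 0 := by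
    have h := LinearMap.mem_ker.mp u.2
    rw [map_sub, map_sub, map_one, map_one, sub_eq_zero, sub_eq_zero]
    exact ⟨congrArg (fun x => (x.1.toMul : S)) h, congrArg (fun x => (x.2.toMul : T)) h⟩
  let ψ : LinearMap.ker φ →+ R :=
    { toFun := fun u => (u.1.toMul : R) - 1
      map_zero' := by simp
      map_add' := fun u v => by
        have h := hfg _ _ (hker u).1 (hker v).2
        simp only [Submodule.coe_add, toMul_add, Units.val_mul]
        linear_combination h }
  have hψ : Function.Injective ψ := fun u v huv =>
    Subtype.ext (Additive.toMul.injective (Units.ext (sub_left_injective huv)))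
  have : IsNoetherian ℤ (LinearMap.ker φ) := isNoetherian_of_injective ψ.toIntLinearMap hψ
  exact isNoetherian_of_range_eq_ker (LinearMap.ker φ).subtype φ (Submodule.range_subtype _)

theorem isNoetherian_additive_units_quotient_mul {R : Type*} [CommRing R] [Module.Finite ℤ R]
    (I J : Ideal R) [IsNoetherian ℤ (Additive (R ⧸ I)ˣ)] [IsNoetherian ℤ (Additive (R ⧸ J)ˣ)] :
    IsNoetherian ℤ (Additive (R ⧸ I * J)ˣ) := by
  refine isNoetherian_additive_units_of_ker_mul_ker
    (Ideal.Quotient.factor (Ideal.mul_le_left : I * J ≤ I))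
    (Ideal.Quotient.factor (Ideal.mul_le_right : I * J ≤ J)) fun a b ha hb => ?_
  obtain ⟨x, rfl⟩ := Ideal.Quotient.mk_surjective a
  obtain ⟨y, rfl⟩ := Ideal.Quotient.mk_surjective b
  rw [Ideal.Quotient.factor_mk, Ideal.Quotient.eq_zero_iff_mem] at ha hb
  rw [← map_mul, Ideal.Quotient.eq_zero_iff_mem]
  exact Ideal.mul_mem_mul ha hb

/-- The unit group of a commutative ring that is finite over `ℤ` is finitely generated. -/
theorem isNoetherian_additive_units (R : Type*) [CommRing R] [Module.Finite ℤ R] :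
    IsNoetherian ℤ (Additive Rˣ) := by
  have : IsNoetherianRing R := IsNoetherianRing.of_finite ℤ R
  have hprod (Z : Multiset (PrimeSpectrum R)) :
      IsNoetherian ℤ (Additive (R ⧸ (Z.map PrimeSpectrum.asIdeal).prod)ˣ) := by
    induction Z using Multiset.induction with
    | empty =>
      have : Subsingleton (R ⧸ (Multiset.map PrimeSpectrum.asIdeal (0 : Multiset _)).prod) :=
        Ideal.Quotient.subsingleton_iff.mpr (by simp)
      infer_instance
    | cons p Z ih =>
      have := isNoetherian_additive_units_of_isDomain (R ⧸ p.asIdeal)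
      rw [Multiset.map_cons, Multiset.prod_cons]
      exact isNoetherian_additive_units_quotient_mul _ _
  obtain ⟨Z, hZ⟩ := PrimeSpectrum.exists_primeSpectrum_prod_le R ⊥
  have := hprod Z
  rw [le_bot_iff.mp hZ] at this
  exact isNoetherian_additive_of_injective
    (Units.mapEquiv (RingEquiv.quotientBot R).symm.toMulEquiv).toMonoidHom
    (Units.mapEquiv (RingEquiv.quotientBot R).symm.toMulEquiv).injective

open scoped IsMulCommutative in
/-- A commutative group of units of a ring that is finite over `ℤ` is finitely generated. -/
theorem Subgroup.fg_of_forall_commute_of_units {R : Type*} [Ring R] [Module.Finite ℤ R]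
    (A : Subgroup Rˣ) (hA : ∀ x ∈ A, ∀ y ∈ A, x * y = y * x) : A.FG := by
  have : IsNoetherian ℤ R := isNoetherian_of_isNoetherianRing_of_finite ℤ R
  let s : Set R := Units.val '' (A : Set Rˣ)
  have hs : ∀ a ∈ s, ∀ b ∈ s, a * b = b * a := by
    rintro _ ⟨x, hx, rfl⟩ _ ⟨y, hy, rfl⟩
    exact congrArg Units.val (hA x hx y hy)
  let : CommGroup A :=
    { (inferInstance : Group A) with mul_comm := fun x y => Subtype.ext (hA x x.2 y y.2) }
  have := Algebra.isMulCommutative_adjoin ℤ hs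
  have : Module.Finite ℤ (Algebra.adjoin ℤ s) :=
    Module.IsNoetherian.finite ℤ (Subalgebra.toSubmodule (Algebra.adjoin ℤ s))
  have := isNoetherian_additive_units (Algebra.adjoin ℤ s)
  let φ : A →* Algebra.adjoin ℤ s :=
    { toFun := fun x => ⟨(x : Rˣ), Algebra.subset_adjoin ⟨x, x.2, rfl⟩⟩
      map_one' := rfl
      map_mul' := fun _ _ => rfl }
  have hφ : Function.Injective φ.toHomUnits := fun x y hxy =>
    Subtype.ext (Units.ext (congrArg (fun u => ((u : (Algebra.adjoin ℤ s)ˣ).val : R)) hxy))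
  have := isNoetherian_additive_of_injective _ hφ
  rw [← Group.fg_iff_subgroup_fg, GroupFG.iff_add_fg, ← Module.Finite.iff_addGroup_fg]
  infer_instance

theorem isDirectSumOfCyclic_of_fg (A : Type) [CommGroup A] [Group.FG A] :
    IsDirectSumOfCyclic A := by
  obtain ⟨m, ι, _, p, _, e, ⟨f⟩⟩ := AddCommGroup.equiv_free_prod_directSum_zmod (Additive A)
  let c : Fin m ⊕ ι → ℕ := Sum.elim (fun _ => 0) fun i => p i ^ e i
  let h : (Fin m →₀ ℤ) × (DirectSum ι fun i => ZMod (p i ^ e i)) ≃+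
      DirectSum (Fin m ⊕ ι) fun i => ZMod (c i) :=
    ((Finsupp.linearEquivFunOnFinite ℤ ℤ (Fin m)).toAddEquiv.prodCongr
      (DirectSum.addEquivProd _)).trans
      ((LinearEquiv.sumPiEquivProdPi ℤ (Fin m) ι fun i => ZMod (c i)).symm.toAddEquiv.trans
        (DirectSum.addEquivProd fun i => ZMod (c i)).symm)
  exact ⟨Fin m ⊕ ι, c, ⟨AddEquiv.toMultiplicativeRight (f.trans h)⟩⟩

/-- `GL_n(ℤ)` belongs to the class `𝒢`: every torsion subgroup is finite and every abelian
subgroup is finitely generated (hence a direct sum of cyclic groups). -/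
theorem GL_int_in_classG (n : ℕ) (hn : 1 ≤ n) :
    InClassG (GL (Fin n) ℤ) ∧
      ∀ A : Subgroup (GL (Fin n) ℤ), (∀ x ∈ A, ∀ y ∈ A, x * y = y * x) → A.FG := by
  have hfg (A : Subgroup (GL (Fin n) ℤ)) (hA : ∀ x ∈ A, ∀ y ∈ A, x * y = y * x) : A.FG :=
    A.fg_of_forall_commute_of_units hA
  refine ⟨⟨Matrix.GeneralLinearGroup.finite_of_forall_isOfFinOrder, fun A hA => ?_⟩, hfg⟩
  let : CommGroup A :=
    { (inferInstance : Group A) with mul_comm := fun x y => Subtype.ext (hA x x.2 y y.2) }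
  have : Group.FG A := (Group.fg_iff_subgroup_fg A).mpr (hfg A hA)
  exact isDirectSumOfCyclic_of_fg A
end
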